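/- Let Δ_ℕ be the simplex on the vertex set ℕ = {1, 2, …}, let Ω be the set of all simplicial subcomplexes of Δ_ℕ with the σ-algebra A' generated by the cylinder sets Z(Y, n) = {X ∈ Ω : X ∩ Δ_n = Y}, and let p_σ ∈ [0,1] (σ a simplex of Δ_ℕ, q_σ = 1 − p_σ) be a system of probability parameters in the medial regime, i.e. there exist 0 < p_− ≤ p_+ < 1 with p_σ ∈ [p_−, p_+] for every simplex σ. Let μ be a probability measure on (Ω, A') satisfying μ(Z(Y, n)) = (∏_{σ ∈ F(Y)} p_σ) · (∏_{σ ∈ E(Y|Δ_n)} q_σ) for every n and every subcomplex Y ⊆ Δ_n. Then the set of X ∈ Ω which are Rado complexes has μ-measure 1. -/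

import Mathlib

/-- An (abstract) simplicial complex with vertices drawn from `ℕ`:
a set of nonempty finite subsets of `ℕ` (the simplexes) closed under
passing to nonempty subsets.  The vertex set `V(X)` is the set of `v`
with `{v}` a simplex. -/
structure SComplex where
  faces : Set (Finset ℕ)
  nonempty_of_mem : ∀ s ∈ faces, s.Nonempty
  down_closed : ∀ s ∈ faces, ∀ t ⊆ s, t.Nonempty → t ∈ faces

namespace SComplex

/-- The vertex set of a simplicial complex. -/
def vertexSet (X : SComplex) : Set ℕ := {v | {v} ∈ X.faces}

/-- The subcomplex of `X` induced on a set `U` of vertices. -/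
def induced (X : SComplex) (U : Set ℕ) : SComplex where
  faces := {s | s ∈ X.faces ∧ (↑s : Set ℕ) ⊆ U}
  nonempty_of_mem := fun s hs => X.nonempty_of_mem s hs.1
  down_closed := fun s hs t hts ht =>
    ⟨X.down_closed s hs.1 t hts ht,
     fun x hx => hs.2 (Finset.mem_coe.mpr (hts (Finset.mem_coe.mp hx)))⟩

/-- The link of a vertex `v`: all simplexes `σ` with `v ∉ σ` and `σ ∪ {v}` a simplex. -/
def link (X : SComplex) (v : ℕ) : SComplex where
  faces := {s | s ∈ X.faces ∧ v ∉ s ∧ insert v s ∈ X.faces}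
  nonempty_of_mem := fun s hs => X.nonempty_of_mem s hs.1
  down_closed := fun s hs t hts ht =>
    ⟨X.down_closed s hs.1 t hts ht,
     fun hv => hs.2.1 (hts hv),
     X.down_closed _ hs.2.2 _ (Finset.insert_subset_insert v hts)
       (Finset.insert_nonempty v t)⟩

/-- `IsIso X Y f` : the map `f` is an isomorphism of simplicial complexes from `X` to `Y`,
i.e. a bijection of the vertex sets which induces a bijection between the sets of simplexes. -/
def IsIso (X Y : SComplex) (f : ℕ → ℕ) : Prop :=
  Set.BijOn f X.vertexSet Y.vertexSet ∧
    ∀ s : Finset ℕ, (↑s : Set ℕ) ⊆ X.vertexSet → (s ∈ X.faces ↔ s.image f ∈ Y.faces)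

/-- Two simplicial complexes are isomorphic. -/
def Isomorphic (X Y : SComplex) : Prop := ∃ f, IsIso X Y f

/-- `X` is universal: every countable simplicial complex is isomorphic to an induced
subcomplex of `X`. -/
def Universal (X : SComplex) : Prop :=
  ∀ Y : SComplex, Y.vertexSet.Countable →
    ∃ U ⊆ X.vertexSet, Isomorphic Y (X.induced U)

/-- `X` is homogeneous: every isomorphism between finite induced subcomplexes of `X`
extends to an isomorphism of `X` onto itself. -/
def Homogeneous (X : SComplex) : Prop :=
  ∀ U U' : Set ℕ, U.Finite → U'.Finite → U ⊆ X.vertexSet → U' ⊆ X.vertexSet →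
    ∀ f : ℕ → ℕ, IsIso (X.induced U) (X.induced U') f →
      ∃ F : ℕ → ℕ, IsIso X X F ∧ Set.EqOn F f U

/-- A Rado complex: a countable simplicial complex which is universal and homogeneous. -/
def IsRado (X : SComplex) : Prop :=
  X.vertexSet.Countable ∧ Universal X ∧ Homogeneous X

/-- The ampleness condition: for every finite `U ⊆ V(X)` and every subcomplex `A` of the
induced complex `X_U` there is a vertex `v ∈ V(X) - U` with `Lk_X(v) ∩ X_U = A`. -/
def AmpleProp (X : SComplex) : Prop :=
  ∀ U : Set ℕ, U.Finite → U ⊆ X.vertexSet →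
    ∀ A : SComplex, A.faces ⊆ (X.induced U).faces →
      ∃ v ∈ X.vertexSet \ U, (X.link v).faces ∩ (X.induced U).faces = A.faces

/-- An ample complex: a countable simplicial complex satisfying the ampleness condition. -/
def IsAmple (X : SComplex) : Prop := X.vertexSet.Countable ∧ AmpleProp X

/-- `L'` is an induced subcomplex of `L`. -/
def IsInduced (L' L : SComplex) : Prop :=
  L'.faces ⊆ L.faces ∧ ∀ s ∈ L.faces, (↑s : Set ℕ) ⊆ L'.vertexSet → s ∈ L'.faces

end SComplex

/-! Every `X : SComplex` is a subcomplex of the simplex `Δ_ℕ` on the vertex set `ℕ`;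
thus `SComplex` itself plays the role of `Ω`, the set of all subcomplexes of `Δ_ℕ`. -/

/-- `X ∩ Δ_n`: the subcomplex of `X` induced on the first `n` vertices. -/
def SComplex.restrictTo (X : SComplex) (n : ℕ) : SComplex :=
  X.induced ↑(Finset.range n)

/-- `Y` is a subcomplex of `Δ_n`, the simplex spanned by the first `n` vertices. -/
def SComplex.On (Y : SComplex) (n : ℕ) : Prop := ∀ s ∈ Y.faces, s ⊆ Finset.range n

/-- The cylinder set `Z(Y, n) = {X ∈ Ω : X ∩ Δ_n = Y}`. -/
def cylinder (Y : SComplex) (n : ℕ) : Set SComplex := {X | X.restrictTo n = Y}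

/-- The σ-algebra `A'` on `Ω` generated by the cylinder sets. -/
instance cylinderSigmaAlgebra : MeasurableSpace SComplex :=
  MeasurableSpace.generateFrom {Z | ∃ n Y, SComplex.On Y n ∧ Z = cylinder Y n}

/-- `E(Y|Δ_n)`: the simplexes of `Δ_n` external for `Y` in `Δ_n`, i.e. the nonempty
subsets of the first `n` vertices which are not simplexes of `Y` but all of whose
proper nonempty subsets are simplexes of `Y`. -/
def externalIn (Y : SComplex) (n : ℕ) : Set (Finset ℕ) :=
  {σ | σ ⊆ Finset.range n ∧ σ.Nonempty ∧ σ ∉ Y.faces ∧ ∀ τ ⊂ σ, τ.Nonempty → τ ∈ Y.faces}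

namespace SComplex

theorem vertexSet_induced {X : SComplex} {U : Set ℕ} (hU : U ⊆ X.vertexSet) :
    (X.induced U).vertexSet = U := by
  ext v
  simp only [vertexSet, induced, Set.mem_ofPred_eq, Finset.coe_singleton,
    Set.singleton_subset_iff]
  exact ⟨fun h => h.2, fun h => ⟨hU h, h⟩⟩

/-- The set `R` of pairs is the graph of an isomorphism between induced subcomplexes
of `Y` and `X`. -/
structure IsPartialIso (Y X : SComplex) (R : Set (ℕ × ℕ)) : Prop where
  fst_mem : ∀ a ∈ R, a.1 ∈ Y.vertexSet
  snd_mem : ∀ a ∈ R, a.2 ∈ X.vertexSet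
  fst_eq_iff : ∀ a ∈ R, ∀ b ∈ R, a.1 = b.1 ↔ a.2 = b.2
  faces_iff : ∀ Q : Finset (ℕ × ℕ), (↑Q : Set (ℕ × ℕ)) ⊆ R →
    (Q.image Prod.fst ∈ Y.faces ↔ Q.image Prod.snd ∈ X.faces)

theorem IsPartialIso.empty (Y X : SComplex) : IsPartialIso Y X ∅ where
  fst_mem := by simp
  snd_mem := by simp
  fst_eq_iff := by simp
  faces_iff Q hQ := by
    have : Q = ∅ := by simpa using hQ
    subst this
    exact ⟨fun h => absurd (Y.nonempty_of_mem _ h) (by simp),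
      fun h => absurd (X.nonempty_of_mem _ h) (by simp)⟩

theorem IsPartialIso.swap {Y X : SComplex} {R : Set (ℕ × ℕ)} (h : IsPartialIso Y X R) :
    IsPartialIso X Y (Prod.swap '' R) where
  fst_mem := by rintro _ ⟨a, ha, rfl⟩; exact h.snd_mem a ha
  snd_mem := by rintro _ ⟨a, ha, rfl⟩; exact h.fst_mem a ha
  fst_eq_iff := by
    rintro _ ⟨a, ha, rfl⟩ _ ⟨b, hb, rfl⟩
    exact (h.fst_eq_iff a ha b hb).symm
  faces_iff Q hQ := by
    have key := h.faces_iff (Q.image Prod.swap) (by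
      intro a ha
      simp only [Finset.coe_image] at ha
      obtain ⟨b, hb, rfl⟩ := ha
      obtain ⟨c, hc, rfl⟩ := hQ hb
      simpa using hc)
    rw [Finset.image_image, Finset.image_image] at key
    exact key.symm

/-- In an ample complex, a finite partial isomorphism extends to any further vertex
of its source. -/
theorem IsPartialIso.exists_insert {Y X : SComplex} (hX : X.AmpleProp) {P : Set (ℕ × ℕ)}
    (hfin : P.Finite) (h : IsPartialIso Y X P) {w : ℕ} (hw : w ∈ Y.vertexSet)
    (hwP : ∀ a ∈ P, a.1 ≠ w) : ∃ v, IsPartialIso Y X (insert (w, v) P) := by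
  have hsub : Prod.snd '' P ⊆ X.vertexSet := by
    rintro _ ⟨a, ha, rfl⟩; exact h.snd_mem a ha
  let A : SComplex :=
    { faces := {s | ∃ Q : Finset (ℕ × ℕ), (↑Q : Set (ℕ × ℕ)) ⊆ P ∧ Q.Nonempty ∧
        Q.image Prod.snd = s ∧ insert w (Q.image Prod.fst) ∈ Y.faces}
      nonempty_of_mem := by
        rintro _ ⟨Q, -, hQ, rfl, -⟩
        exact hQ.image _
      down_closed := by
        rintro _ ⟨Q, hQP, -, rfl, hQY⟩ t ht htn
        obtain ⟨Q', hQ', rfl⟩ := Finset.subset_image_iff.1 ht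
        have hQ'' : Q' ⊆ Q := by exact_mod_cast hQ'
        exact ⟨Q', (Finset.coe_subset.2 hQ'').trans hQP, by simpa using htn, rfl,
          Y.down_closed _ hQY _ (Finset.insert_subset_insert _ (Finset.image_subset_image hQ''))
            (Finset.insert_nonempty _ _)⟩ }
  have hA : A.faces ⊆ (X.induced (Prod.snd '' P)).faces := by
    rintro _ ⟨Q, hQP, hQ, rfl, hQY⟩
    refine ⟨(h.faces_iff Q hQP).1 (Y.down_closed _ hQY _ (Finset.subset_insert _ _)
      (hQ.image _)), ?_⟩
    rw [Finset.coe_image]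
    exact Set.image_mono hQP
  obtain ⟨v, ⟨hvX, hvU⟩, hv⟩ := hX _ (hfin.image _) hsub A hA
  have hvP : ∀ a ∈ P, a.2 ≠ v := fun a ha hav => hvU ⟨a, ha, hav⟩
  refine ⟨v, ?_, ?_, ?_, ?_⟩
  · rintro a (rfl | ha)
    exacts [hw, h.fst_mem a ha]
  · rintro a (rfl | ha)
    exacts [hvX, h.snd_mem a ha]
  · rintro a (rfl | ha) b (rfl | hb)
    · simp
    · simp [(hwP b hb).symm, (hvP b hb).symm]
    · simp [hwP a ha, hvP a ha]
    · exact h.fst_eq_iff a ha b hb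
  · intro Q hQ
    by_cases hmem : (w, v) ∈ Q
    swap
    · refine h.faces_iff Q fun a ha => (hQ ha).resolve_left ?_
      rintro rfl
      exact hmem ha
    obtain ⟨Q', hnot, rfl⟩ : ∃ Q', (w, v) ∉ Q' ∧ insert (w, v) Q' = Q :=
      ⟨Q.erase (w, v), by simp, Finset.insert_erase hmem⟩
    have hQ' : (↑Q' : Set (ℕ × ℕ)) ⊆ P := by
      intro a ha
      refine (hQ (by simp [Finset.mem_coe.1 ha])).resolve_left ?_
      rintro rfl
      exact hnot ha
    simp only [Finset.image_insert]
    rcases Q'.eq_empty_or_nonempty with rfl | hne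
    · exact iff_of_true hw hvX
    constructor
    · intro hY
      have : Q'.image Prod.snd ∈ A.faces := ⟨Q', hQ', hne, rfl, hY⟩
      rw [← hv] at this
      exact this.1.2.2
    · intro hXf
      have hXQ : Q'.image Prod.snd ∈ X.faces :=
        X.down_closed _ hXf _ (Finset.subset_insert _ _) (hne.image _)
      have hsubU : (↑(Q'.image Prod.snd) : Set ℕ) ⊆ Prod.snd '' P := by
        rw [Finset.coe_image]
        exact Set.image_mono hQ'
      have : Q'.image Prod.snd ∈ A.faces := by
        rw [← hv]
        exact ⟨⟨hXQ, fun hvm => hvU (hsubU hvm), hXf⟩, hXQ, hsubU⟩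
      obtain ⟨Q'', hQ''P, -, heq, hY⟩ := this
      have hQQ : Q'.image Prod.fst ⊆ Q''.image Prod.fst := by
        intro x hx
        obtain ⟨a, ha, rfl⟩ := Finset.mem_image.1 hx
        have hm : a.2 ∈ Q''.image Prod.snd := heq ▸ Finset.mem_image_of_mem _ ha
        obtain ⟨b, hb, hab⟩ := Finset.mem_image.1 hm
        rw [← (h.fst_eq_iff b (hQ''P hb) a (hQ' ha)).2 hab]
        exact Finset.mem_image_of_mem _ hb
      exact Y.down_closed _ hY _ (Finset.insert_subset_insert _ hQQ)
        (Finset.insert_nonempty _ _)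

theorem IsPartialIso.exists_fst_mem {Y X : SComplex} (hX : X.AmpleProp) {P : Set (ℕ × ℕ)}
    (hfin : P.Finite) (h : IsPartialIso Y X P) {w : ℕ} (hw : w ∈ Y.vertexSet) :
    ∃ P', P ⊆ P' ∧ P'.Finite ∧ IsPartialIso Y X P' ∧ ∃ v, (w, v) ∈ P' := by
  by_cases hwP : ∀ a ∈ P, a.1 ≠ w
  · obtain ⟨v, hv⟩ := h.exists_insert hX hfin hw hwP
    exact ⟨_, Set.subset_insert _ _, hfin.insert _, hv, v, Set.mem_insert _ _⟩
  · push Not at hwP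
    obtain ⟨a, ha, rfl⟩ := hwP
    exact ⟨P, subset_rfl, hfin, h, a.2, ha⟩

theorem IsPartialIso.exists_snd_mem {Y X : SComplex} (hY : Y.AmpleProp) {P : Set (ℕ × ℕ)}
    (hfin : P.Finite) (h : IsPartialIso Y X P) {v : ℕ} (hv : v ∈ X.vertexSet) :
    ∃ P', P ⊆ P' ∧ P'.Finite ∧ IsPartialIso Y X P' ∧ ∃ w, (w, v) ∈ P' := by
  obtain ⟨P', hPP', hfin', h', w, hw⟩ := h.swap.exists_fst_mem hY (hfin.image _) hv
  exact ⟨Prod.swap '' P', fun a ha => ⟨a.swap, hPP' ⟨a, ha, rfl⟩, a.swap_swap⟩,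
    hfin'.image _, h'.swap, w, (v, w), hw, rfl⟩

theorem IsPartialIso.sUnion {Y X : SComplex} {S : Set (Set (ℕ × ℕ))} (hne : S.Nonempty)
    (hdir : DirectedOn (· ⊆ ·) S) (h : ∀ P ∈ S, IsPartialIso Y X P) :
    IsPartialIso Y X (⋃₀ S) where
  fst_mem := by rintro a ⟨P, hP, ha⟩; exact (h P hP).fst_mem a ha
  snd_mem := by rintro a ⟨P, hP, ha⟩; exact (h P hP).snd_mem a ha
  fst_eq_iff := by
    rintro a ⟨P, hP, ha⟩ b ⟨P', hP', hb⟩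
    obtain ⟨T, hT, hPT, hPT'⟩ := hdir P hP P' hP'
    exact (h T hT).fst_eq_iff a (hPT ha) b (hPT' hb)
  faces_iff Q hQ := by
    obtain ⟨P, hP, hQP⟩ :=
      DirectedOn.exists_mem_subset_of_finset_subset_biUnion (f := id) hne hdir
        (by simpa [Set.sUnion_eq_biUnion] using hQ)
    exact (h P hP).faces_iff Q hQP

/-- Rasiowa–Sikorski for finite partial isomorphisms: countably many extension requirements
can be met simultaneously. -/
theorem IsPartialIso.exists_generic {Y X : SComplex} {ι : Type*} [Countable ι]
    (G : ι → Set (ℕ × ℕ) → Prop)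
    (hmono : ∀ i P P', P ⊆ P' → G i P → G i P')
    (hG : ∀ i (P : Set (ℕ × ℕ)), P.Finite → IsPartialIso Y X P →
      ∃ P', P ⊆ P' ∧ P'.Finite ∧ IsPartialIso Y X P' ∧ G i P')
    {P : Set (ℕ × ℕ)} (hfin : P.Finite) (h : IsPartialIso Y X P) :
    ∃ R, P ⊆ R ∧ IsPartialIso Y X R ∧ ∀ i, G i R := by
  have := Encodable.ofCountable ι
  let D := {T : Set (ℕ × ℕ) // T.Finite ∧ IsPartialIso Y X T}
  let C : ι → Order.Cofinal D := fun i =>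
    { carrier := {T | G i T.1}
      isCofinal := fun T => by
        obtain ⟨T', h1, h2, h3, h4⟩ := hG i T.1 T.2.1 T.2.2
        exact ⟨⟨T', h2, h3⟩, h4, h1⟩ }
  let I := Order.idealOfCofinals (⟨P, hfin, h⟩ : D) C
  have hPI : (⟨P, hfin, h⟩ : D) ∈ I := Order.mem_idealOfCofinals _ _
  refine ⟨⋃₀ (Subtype.val '' (I : Set D)), Set.subset_sUnion_of_mem ⟨_, hPI, rfl⟩,
    .sUnion ⟨_, _, hPI, rfl⟩ ?_ ?_, fun i => ?_⟩
  · rintro _ ⟨a, ha, rfl⟩ _ ⟨b, hb, rfl⟩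
    obtain ⟨c, hc, hac, hbc⟩ := I.directed a ha b hb
    exact ⟨c.1, ⟨c, hc, rfl⟩, hac, hbc⟩
  · rintro _ ⟨a, -, rfl⟩
    exact a.2.2
  · obtain ⟨T, hT, hTI⟩ := Order.cofinal_meets_idealOfCofinals (⟨P, hfin, h⟩ : D) C i
    exact hmono i _ _ (Set.subset_sUnion_of_mem ⟨T, hTI, rfl⟩) hT

theorem IsPartialIso.injOn {Y X : SComplex} {R : Set (ℕ × ℕ)} (h : IsPartialIso Y X R)
    {f : ℕ → ℕ} (hf : ∀ w ∈ Y.vertexSet, (w, f w) ∈ R) : Set.InjOn f Y.vertexSet :=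
  fun a ha b hb hab => (h.fst_eq_iff _ (hf a ha) _ (hf b hb)).2 hab

theorem IsPartialIso.mem_faces_iff {Y X : SComplex} {R : Set (ℕ × ℕ)}
    (h : IsPartialIso Y X R) {f : ℕ → ℕ} (hf : ∀ w ∈ Y.vertexSet, (w, f w) ∈ R)
    {s : Finset ℕ} (hs : (↑s : Set ℕ) ⊆ Y.vertexSet) :
    s ∈ Y.faces ↔ s.image f ∈ X.faces := by
  have := h.faces_iff (s.image fun w => (w, f w)) (by
    intro a ha
    rw [Finset.coe_image] at ha
    obtain ⟨w, hw, rfl⟩ := ha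
    exact hf w (hs hw))
  simpa [Finset.image_image, Function.comp_def] using this

theorem AmpleProp.universal {X : SComplex} (hX : X.AmpleProp) : X.Universal := by
  intro Y _
  obtain ⟨R, -, hR, htot⟩ := IsPartialIso.exists_generic (Y := Y) (X := X)
    (fun (w : ℕ) P => w ∈ Y.vertexSet → ∃ v, (w, v) ∈ P)
    (fun _ _ _ hPP' hG hw => (hG hw).imp fun _ hv => hPP' hv)
    (fun w P hfin h => by
      by_cases hw : w ∈ Y.vertexSet
      · obtain ⟨P', h1, h2, h3, h4⟩ := h.exists_fst_mem hX hfin hw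
        exact ⟨P', h1, h2, h3, fun _ => h4⟩
      · exact ⟨P, subset_rfl, hfin, h, fun hw' => absurd hw' hw⟩)
    Set.finite_empty (IsPartialIso.empty Y X)
  choose! f hf using htot
  have hsub : f '' Y.vertexSet ⊆ X.vertexSet := by
    rintro _ ⟨w, hw, rfl⟩
    exact hR.snd_mem _ (hf w hw)
  refine ⟨f '' Y.vertexSet, hsub, f, ?_, fun s hs => ?_⟩
  · rw [vertexSet_induced hsub]
    exact (hR.injOn hf).bijOn_image
  · rw [hR.mem_faces_iff hf hs]
    refine ⟨fun hX => ⟨hX, ?_⟩, fun hX => hX.1⟩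
    rw [Finset.coe_image]
    exact Set.image_mono hs

theorem AmpleProp.homogeneous {X : SComplex} (hX : X.AmpleProp) : X.Homogeneous := by
  intro U U' hU _ hUX hUX' f hf
  obtain ⟨hbij, hfaces⟩ := hf
  rw [vertexSet_induced hUX, vertexSet_induced hUX'] at hbij
  rw [vertexSet_induced hUX] at hfaces
  have hP : IsPartialIso X X ((fun u => (u, f u)) '' U) := by
    refine ⟨?_, ?_, ?_, ?_⟩
    · rintro _ ⟨u, hu, rfl⟩
      exact hUX hu
    · rintro _ ⟨u, hu, rfl⟩
      exact hUX' (hbij.mapsTo hu)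
    · rintro _ ⟨u, hu, rfl⟩ _ ⟨u', hu', rfl⟩
      exact (hbij.injOn.eq_iff hu hu').symm
    · intro Q hQ
      obtain ⟨s, hs, rfl⟩ := Finset.subset_set_image_iff.1 hQ
      have hs' : (↑(s.image f) : Set ℕ) ⊆ U' := by
        rw [Finset.coe_image]
        exact (Set.image_mono hs).trans hbij.image_eq.subset
      have := hfaces s hs
      simp only [induced, Set.mem_ofPred_eq, hs, hs', and_true] at this
      simpa [Finset.image_image, Function.comp_def] using this
  obtain ⟨R, hPR, hR, htot⟩ := IsPartialIso.exists_generic (Y := X) (X := X)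
    (fun (w : ℕ) P => w ∈ X.vertexSet → (∃ v, (w, v) ∈ P) ∧ ∃ v, (v, w) ∈ P)
    (fun _ _ _ hPP' hG hw =>
      ⟨(hG hw).1.imp fun _ hv => hPP' hv, (hG hw).2.imp fun _ hv => hPP' hv⟩)
    (fun w P hfin h => by
      by_cases hw : w ∈ X.vertexSet
      · obtain ⟨P', h1, h2, h3, v, hv⟩ := h.exists_fst_mem hX hfin hw
        obtain ⟨P'', h1', h2', h3', h4'⟩ := h3.exists_snd_mem hX h2 hw
        exact ⟨P'', h1.trans h1', h2', h3', fun _ => ⟨⟨v, h1' hv⟩, h4'⟩⟩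
      · exact ⟨P, subset_rfl, hfin, h, fun hw' => absurd hw' hw⟩)
    (hU.image _) hP
  have hleft : ∀ w ∈ X.vertexSet, ∃ v, (w, v) ∈ R := fun w hw => (htot w hw).1
  choose! F hF using hleft
  refine ⟨F, ⟨⟨fun w hw => hR.snd_mem _ (hF w hw), hR.injOn hF, fun v hv => ?_⟩,
    fun s hs => hR.mem_faces_iff hF hs⟩, fun u hu => ?_⟩
  · obtain ⟨w, hw⟩ := (htot v hv).2
    have hwX := hR.fst_mem _ hw
    exact ⟨w, hwX, (hR.fst_eq_iff _ (hF w hwX) _ hw).1 rfl⟩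
  · exact (hR.fst_eq_iff _ (hF u (hUX hu)) _ (hPR ⟨u, hu, rfl⟩)).1 rfl

theorem AmpleProp.isRado {X : SComplex} (hX : X.AmpleProp) : X.IsRado :=
  ⟨Set.to_countable _, hX.universal, hX.homogeneous⟩

/-- `v` realises the link `A` over `U`: it is a vertex outside `U`, and a simplex of `X`
inside `U` spans a simplex with `v` exactly when it lies in `A`. -/
def Realizes (X : SComplex) (U : Finset ℕ) (A : Finset (Finset ℕ)) (v : ℕ) : Prop :=
  v ∉ U ∧ {v} ∈ X.faces ∧ ∀ σ ∈ U.powerset, σ ∈ X.faces → (insert v σ ∈ X.faces ↔ σ ∈ A)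

theorem ampleProp_of_forall_realizes {X : SComplex}
    (h : ∀ (U : Finset ℕ) (A : Finset (Finset ℕ)),
      (∀ σ ∈ A, ∀ τ ⊆ σ, τ.Nonempty → τ ∈ A) → (∀ σ ∈ A, σ ∈ X.faces) →
        ∃ v, X.Realizes U A v) : X.AmpleProp := by
  intro U hU _ A hA
  lift U to Finset ℕ using hU
  have hfin : A.faces.Finite := U.powerset.finite_toSet.subset fun s hs => by
    simpa using (hA hs).2
  obtain ⟨v, hvU, hvX, hv⟩ := h U hfin.toFinset
    (fun σ hσ τ hτ hne => by
      simp only [Set.Finite.mem_toFinset] at hσ ⊢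
      exact A.down_closed σ hσ τ hτ hne)
    (fun σ hσ => (hA ((Set.Finite.mem_toFinset _).1 hσ)).1)
  refine ⟨v, ⟨hvX, by simpa using hvU⟩, ?_⟩
  ext s
  constructor
  · rintro ⟨⟨-, -, hs⟩, hsX, hsU⟩
    simpa using (hv s (by simpa using hsU) hsX).1 hs
  · intro hs
    obtain ⟨hsX, hsU⟩ := hA hs
    exact ⟨⟨hsX, fun hvs => hvU (hsU hvs),
      (hv s (by simpa using hsU) hsX).2 (by simpa using hs)⟩, hsX, hsU⟩

/-- The complex whose simplexes are the finite sets all of whose nonempty subsets are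
marked `true`. -/
def ofBits (ω : Finset ℕ → Bool) : SComplex where
  faces := {s | s.Nonempty ∧ ∀ t ⊆ s, t.Nonempty → ω t = true}
  nonempty_of_mem _ hs := hs.1
  down_closed _ hs _ hts ht := ⟨ht, fun u hu hun => hs.2 u (hu.trans hts) hun⟩

theorem faces_injective : Function.Injective faces := by
  rintro ⟨_, _, _⟩ ⟨_, _, _⟩ rfl
  rfl

theorem ofBits_mem_cylinder_iff {Y : SComplex} {n : ℕ} (hY : Y.On n) {ω : Finset ℕ → Bool} :
    ofBits ω ∈ cylinder Y n ↔
      (∀ σ ∈ Y.faces, ω σ = true) ∧ ∀ σ ∈ externalIn Y n, ω σ = false := by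
  have hres : ∀ s, s ∈ ((ofBits ω).restrictTo n).faces ↔
      s ∈ (ofBits ω).faces ∧ s ⊆ Finset.range n := fun s => by
    simp only [restrictTo, induced, Set.mem_ofPred_eq, Finset.coe_subset]
  constructor
  · intro h
    have hmem : ∀ s, s ∈ Y.faces ↔ s ∈ (ofBits ω).faces ∧ s ⊆ Finset.range n := fun s => by
      rw [← hres, show (ofBits ω).restrictTo n = Y from h]
    refine ⟨fun σ hσ => ((hmem σ).1 hσ).1.2 σ subset_rfl (Y.nonempty_of_mem σ hσ), ?_⟩
    rintro σ ⟨hσn, hne, hσY, hsub⟩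
    by_contra hω
    refine hσY ((hmem σ).2 ⟨⟨hne, fun t ht htn => ?_⟩, hσn⟩)
    rcases ht.eq_or_ssubset with rfl | hss
    · simpa using hω
    · exact ((hmem t).1 (hsub t hss htn)).1.2 t subset_rfl htn
  · rintro ⟨hF, hE⟩
    refine faces_injective (Set.ext fun s => ?_)
    rw [hres]
    constructor
    · rintro ⟨hs, hsn⟩
      induction s using Finset.strongInduction with
      | H s ih =>
        by_contra hsY
        have := hE s ⟨hsn, hs.1, hsY, fun t ht htn =>
          ih t ht ((ofBits ω).down_closed s hs t ht.subset htn) (ht.subset.trans hsn)⟩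
        simp [hs.2 s subset_rfl hs.1] at this
    · exact fun hs => ⟨⟨Y.nonempty_of_mem s hs,
        fun t ht htn => hF t (Y.down_closed s hs t ht htn)⟩, hY s hs⟩

theorem On.finite_faces {Y : SComplex} {n : ℕ} (hY : Y.On n) : Y.faces.Finite :=
  (Finset.range n).powerset.finite_toSet.subset fun s hs =>
    Finset.mem_coe.2 (Finset.mem_powerset.2 (hY s hs))

theorem finite_externalIn (Y : SComplex) (n : ℕ) : (externalIn Y n).Finite :=
  (Finset.range n).powerset.finite_toSet.subset fun _ hs =>
    Finset.mem_coe.2 (Finset.mem_powerset.2 hs.1)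

theorem finite_setOf_on (n : ℕ) : {Y : SComplex | Y.On n}.Finite := by
  refine Set.Finite.of_finite_image (f := faces) ?_ faces_injective.injOn
  refine ((Finset.range n).powerset.finite_toSet.powerset).subset ?_
  rintro _ ⟨Y, hY, rfl⟩ s hs
  exact Finset.mem_coe.2 (Finset.mem_powerset.2 (hY s hs))

theorem restrictTo_on (X : SComplex) (n : ℕ) : (X.restrictTo n).On n :=
  fun _ hs => Finset.coe_subset.1 hs.2

theorem measurableSet_cylinder {Y : SComplex} {n : ℕ} (hY : Y.On n) :
    MeasurableSet (cylinder Y n) :=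
  MeasurableSpace.measurableSet_generateFrom ⟨n, Y, hY, rfl⟩

@[fun_prop]
theorem measurable_mem_faces (s : Finset ℕ) : Measurable fun X : SComplex => s ∈ X.faces := by
  refine measurableSet_setOfPred.1 ?_
  obtain ⟨n, hn⟩ := s.exists_nat_subset_range
  have : {X : SComplex | s ∈ X.faces} =
      ⋃ Y ∈ {Y : SComplex | Y.On n ∧ s ∈ Y.faces}, cylinder Y n := by
    ext X
    simp only [Set.mem_iUnion, Set.mem_ofPred_eq, exists_prop]
    constructor
    · exact fun hs => ⟨X.restrictTo n, ⟨X.restrictTo_on n, hs, Finset.coe_subset.2 hn⟩, rfl⟩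
    · rintro ⟨Y, ⟨-, hs⟩, hXY⟩
      rw [← show X.restrictTo n = Y from hXY] at hs
      exact hs.1
  rw [this]
  exact MeasurableSet.biUnion ((finite_setOf_on n).subset fun Y hY => hY.1).countable
    fun Y hY => measurableSet_cylinder hY.1

theorem measurable_realizes (U : Finset ℕ) (A : Finset (Finset ℕ)) (v : ℕ) :
    Measurable fun X : SComplex => X.Realizes U A v := by
  unfold Realizes
  fun_prop

theorem restrictTo_restrictTo {X : SComplex} {m n : ℕ} (hmn : m ≤ n) :
    (X.restrictTo n).restrictTo m = X.restrictTo m := by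
  refine faces_injective (Set.ext fun s => ⟨fun h => ⟨h.1.1, h.2⟩, fun h => ⟨⟨h.1, ?_⟩, h.2⟩⟩)
  exact h.2.trans (Finset.coe_subset.2 (Finset.range_mono hmn))

theorem cylinder_subset_cylinder {Y Y' X : SComplex} {m n : ℕ} (hmn : m ≤ n)
    (hX : X ∈ cylinder Y m) (hX' : X ∈ cylinder Y' n) : cylinder Y' n ⊆ cylinder Y m := by
  intro Z hZ
  simp only [cylinder, Set.mem_ofPred_eq] at *
  rw [← restrictTo_restrictTo hmn, hZ, ← hX', restrictTo_restrictTo hmn, hX]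

theorem isPiSystem_cylinder :
    IsPiSystem {Z | ∃ n Y, SComplex.On Y n ∧ Z = cylinder Y n} := by
  rintro _ ⟨m, Y, hY, rfl⟩ _ ⟨n, Y', hY', rfl⟩ ⟨X, hX, hX'⟩
  rcases le_total m n with h | h
  · exact ⟨n, Y', hY', Set.inter_eq_right.2 (cylinder_subset_cylinder h hX hX')⟩
  · exact ⟨m, Y, hY, Set.inter_eq_left.2 (cylinder_subset_cylinder h hX' hX)⟩

open MeasureTheory ProbabilityTheory

theorem measurable_ofBits : Measurable ofBits := by
  refine measurable_generateFrom ?_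
  rintro _ ⟨n, Y, hY, rfl⟩
  have : ofBits ⁻¹' cylinder Y n = {ω | (∀ σ ∈ Y.faces, ω σ = true) ∧
      ∀ σ ∈ externalIn Y n, ω σ = false} := Set.ext fun ω => ofBits_mem_cylinder_iff hY
  rw [this]
  measurability

/-- The law of a bit equal to `true` with probability `x`. -/
noncomputable def bitLaw (x : ℝ) : Measure Bool :=
  ENNReal.ofReal x • Measure.dirac true + ENNReal.ofReal (1 - x) • Measure.dirac false

theorem bitLaw_true (x : ℝ) : bitLaw x {true} = ENNReal.ofReal x := by
  simp [bitLaw]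

theorem bitLaw_false (x : ℝ) : bitLaw x {false} = ENNReal.ofReal (1 - x) := by
  simp [bitLaw]

theorem isProbabilityMeasure_bitLaw {x : ℝ} (hx : 0 ≤ x) (hx' : x ≤ 1) :
    IsProbabilityMeasure (bitLaw x) := by
  refine ⟨?_⟩
  simp only [bitLaw, Measure.coe_add, Measure.coe_smul, Pi.add_apply, Pi.smul_apply,
    measure_univ, smul_eq_mul, mul_one]
  rw [← ENNReal.ofReal_add hx (by linarith)]
  simp

section Product

variable (p : Finset ℕ → ℝ) [∀ σ, IsProbabilityMeasure (bitLaw (p σ))]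

theorem infinitePi_bitLaw_pi (S : Finset (Finset ℕ)) (b : Finset ℕ → Bool) :
    Measure.infinitePi (fun σ => bitLaw (p σ)) (Set.pi S fun σ => {b σ}) =
      ∏ σ ∈ S, bitLaw (p σ) {b σ} :=
  Measure.infinitePi_pi _ fun _ _ => measurableSet_singleton _

theorem map_ofBits_cylinder (hp0 : ∀ σ, 0 ≤ p σ) (hp1 : ∀ σ, p σ ≤ 1) {Y : SComplex} {n : ℕ}
    (hY : Y.On n) :
    (Measure.infinitePi fun σ => bitLaw (p σ)).map ofBits (cylinder Y n) =
      ENNReal.ofReal ((∏ᶠ σ ∈ Y.faces, p σ) * ∏ᶠ σ ∈ externalIn Y n, (1 - p σ)) := by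
  classical
  rw [Measure.map_apply measurable_ofBits (measurableSet_cylinder hY)]
  set F := hY.finite_faces.toFinset with hF
  set E := (finite_externalIn Y n).toFinset with hE
  have hdisj : Disjoint F E := Finset.disjoint_left.2 fun σ hσ hσ' => by
    simp only [hF, hE, Set.Finite.mem_toFinset] at hσ hσ'
    exact hσ'.2.2.1 hσ
  have hpre : ofBits ⁻¹' cylinder Y n =
      Set.pi ↑(F ∪ E) fun σ => {decide (σ ∈ Y.faces)} := by
    ext ω
    rw [Set.mem_preimage, ofBits_mem_cylinder_iff hY]
    simp only [Set.mem_pi, Finset.coe_union, Set.mem_union, Set.Finite.coe_toFinset, hF, hE,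
      Set.mem_singleton_iff, or_imp, forall_and]
    refine and_congr (forall₂_congr fun σ hσ => ?_) (forall₂_congr fun σ hσ => ?_)
    · simp [hσ]
    · simp [hσ.2.2.1]
  rw [hpre, infinitePi_bitLaw_pi, Finset.prod_union hdisj,
    finprod_mem_eq_finite_toFinset_prod _ hY.finite_faces,
    finprod_mem_eq_finite_toFinset_prod _ (finite_externalIn Y n),
    ENNReal.ofReal_mul (Finset.prod_nonneg fun σ _ => hp0 σ),
    ENNReal.ofReal_prod_of_nonneg fun σ _ => hp0 σ,
    ENNReal.ofReal_prod_of_nonneg fun σ _ => sub_nonneg.2 (hp1 σ)]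
  congr 1
  · refine Finset.prod_congr rfl fun σ hσ => ?_
    have : σ ∈ Y.faces := by simpa [hF] using hσ
    simp [this, bitLaw_true]
  · refine Finset.prod_congr rfl fun σ hσ => ?_
    have : σ ∈ externalIn Y n := by simpa [hE] using hσ
    simp [this.2.2.1, bitLaw_false]

/-- The bits which decide how the vertex `v` attaches to `U`. -/
def coneOver (U : Finset ℕ) (v : ℕ) : Finset (Finset ℕ) := U.powerset.image (insert v)

theorem mem_coneOver {U : Finset ℕ} {v : ℕ} {τ : Finset ℕ} :
    τ ∈ coneOver U v ↔ ∃ σ ⊆ U, insert v σ = τ := by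
  simp [coneOver]

theorem disjoint_coneOver {U : Finset ℕ} {v w : ℕ} (hv : v ∉ U) (hvw : v ≠ w) :
    Disjoint (coneOver U v) (coneOver U w) := by
  refine Finset.disjoint_left.2 fun τ h1 h2 => ?_
  obtain ⟨σ, -, rfl⟩ := mem_coneOver.1 h1
  obtain ⟨σ', hσ', h⟩ := mem_coneOver.1 h2
  have : v ∈ insert w σ' := h ▸ Finset.mem_insert_self v σ
  rcases Finset.mem_insert.1 this with h' | h'
  exacts [hvw h', hv (hσ' h')]

theorem card_coneOver_le (U : Finset ℕ) (v : ℕ) : (coneOver U v).card ≤ 2 ^ U.card :=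
  Finset.card_image_le.trans (Finset.card_powerset U).le

/-- The bits forcing a new vertex to have link `A` over `U`. -/
def linkBit (U : Finset ℕ) (A : Finset (Finset ℕ)) (τ : Finset ℕ) : Bool :=
  decide (τ ∩ U = ∅ ∨ τ ∩ U ∈ A)

theorem linkBit_insert {U : Finset ℕ} {A : Finset (Finset ℕ)} {v : ℕ} (hv : v ∉ U)
    {σ : Finset ℕ} (hσ : σ ⊆ U) : linkBit U A (insert v σ) = decide (σ = ∅ ∨ σ ∈ A) := by
  rw [linkBit, Finset.insert_inter_of_notMem hv, Finset.inter_eq_left.2 hσ]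

theorem ofBits_realizes {U : Finset ℕ} {A : Finset (Finset ℕ)}
    (hA : ∀ σ ∈ A, ∀ τ ⊆ σ, τ.Nonempty → τ ∈ A) {v : ℕ} (hv : v ∉ U) {ω : Finset ℕ → Bool}
    (hω : ω ∈ Set.pi (coneOver U v : Set (Finset ℕ)) fun τ => {linkBit U A τ}) :
    (ofBits ω).Realizes U A v := by
  have hbit : ∀ σ ⊆ U, ω (insert v σ) = decide (σ = ∅ ∨ σ ∈ A) := fun σ hσ => by
    rw [← linkBit_insert hv hσ]
    exact hω _ (Finset.mem_coe.2 (mem_coneOver.2 ⟨σ, hσ, rfl⟩))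
  refine ⟨hv, ⟨by simp, fun t ht htn => ?_⟩, fun σ hσ hσX => ?_⟩
  · rcases Finset.subset_singleton_iff.1 ht with rfl | rfl
    · simp at htn
    · simpa using hbit ∅ (Finset.empty_subset _)
  rw [Finset.mem_powerset] at hσ
  constructor
  · intro h
    have := h.2 _ subset_rfl (Finset.insert_nonempty _ _)
    rw [hbit σ hσ] at this
    exact (of_decide_eq_true this).resolve_left hσX.1.ne_empty
  · refine fun hσA => ⟨Finset.insert_nonempty _ _, fun t ht htn => ?_⟩
    by_cases hvt : v ∈ t
    · have hsub : t.erase v ⊆ σ := Finset.subset_insert_iff.1 ht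
      rw [← Finset.insert_erase hvt, hbit _ (hsub.trans hσ), decide_eq_true_eq]
      exact (t.erase v).eq_empty_or_nonempty.imp_right (hA σ hσA _ hsub)
    · exact hσX.2 t ((Finset.subset_insert_iff_of_notMem hvt).1 ht) htn

theorem ae_exists_realizes {ε : ℝ} (hε : 0 < ε) (hp0 : ∀ σ, ε ≤ p σ) (hp1 : ∀ σ, ε ≤ 1 - p σ)
    (U : Finset ℕ) {A : Finset (Finset ℕ)}
    (hA : ∀ σ ∈ A, ∀ τ ⊆ σ, τ.Nonempty → τ ∈ A) :
    ∀ᵐ ω ∂(Measure.infinitePi fun σ => bitLaw (p σ)), ∃ v, (ofBits ω).Realizes U A v := by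
  obtain ⟨N, hN⟩ := U.exists_nat_subset_range
  have hout : ∀ k, N + k ∉ U := fun k hk => by simpa using hN hk
  let B : ℕ → Set (Finset ℕ → Bool) := fun k =>
    Set.pi (coneOver U (N + k) : Set (Finset ℕ)) fun τ => {linkBit U A τ}
  have hBmeas : ∀ k, MeasurableSet (B k) := fun k =>
    MeasurableSet.pi (Finset.countable_toSet _) fun _ _ => measurableSet_singleton _
  have hind : iIndepSet B (Measure.infinitePi fun σ => bitLaw (p σ)) := by
    rw [iIndepSet_iff_meas_biInter hBmeas]
    intro s
    have : ⋂ k ∈ s, B k = Set.pi ↑(s.biUnion fun k => coneOver U (N + k))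
        fun τ => {linkBit U A τ} := by
      ext ω
      simp only [B, Set.mem_iInter, Set.mem_pi, Finset.coe_biUnion, Set.mem_iUnion]
      exact ⟨fun h τ ⟨k, hk, hτ⟩ => h k hk τ hτ, fun h k hk τ hτ => h τ ⟨k, hk, hτ⟩⟩
    rw [this, infinitePi_bitLaw_pi, Finset.prod_biUnion]
    · exact Finset.prod_congr rfl fun k _ => (infinitePi_bitLaw_pi p _ _).symm
    · exact fun k _ l _ hkl => disjoint_coneOver (hout k) (by simpa using hkl)
  have hbit : ∀ σ b, ENNReal.ofReal ε ≤ bitLaw (p σ) {b} := by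
    rintro σ (_ | _)
    · rw [bitLaw_false]; exact ENNReal.ofReal_le_ofReal (hp1 σ)
    · rw [bitLaw_true]; exact ENNReal.ofReal_le_ofReal (hp0 σ)
  have hε1 : ENNReal.ofReal ε ≤ 1 := (hbit ∅ true).trans prob_le_one
  have hlow : ∀ k, ENNReal.ofReal ε ^ 2 ^ U.card ≤
      Measure.infinitePi (fun σ => bitLaw (p σ)) (B k) := fun k => by
    rw [infinitePi_bitLaw_pi]
    calc ENNReal.ofReal ε ^ 2 ^ U.card
        ≤ ENNReal.ofReal ε ^ (coneOver U (N + k)).card :=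
          pow_le_pow_right_of_le_one' hε1 (card_coneOver_le _ _)
      _ = ∏ _τ ∈ coneOver U (N + k), ENNReal.ofReal ε := by simp
      _ ≤ _ := Finset.prod_le_prod' fun τ _ => hbit τ _
  have hsum : ∑' k, Measure.infinitePi (fun σ => bitLaw (p σ)) (B k) = ⊤ := by
    refine top_le_iff.1 (le_trans (top_le_iff.2 ?_) (ENNReal.tsum_le_tsum hlow))
    exact ENNReal.tsum_const_eq_top_of_ne_zero (pow_ne_zero _ (by simpa using hε))
  have hlim := measure_limsup_eq_one hBmeas hind hsum
  rw [prob_compl_eq_zero_iff (MeasurableSet.measurableSet_limsup hBmeas) |>.symm] at hlim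
  filter_upwards [compl_mem_ae_iff.2 hlim] with ω hω
  rw [compl_compl, Filter.mem_limsup_iff_frequently_mem] at hω
  obtain ⟨k, hk⟩ := hω.exists
  exact ⟨N + k, ofBits_realizes hA (hout k) hk⟩

theorem ae_isRado {ε : ℝ} (hε : 0 < ε) (hp0 : ∀ σ, ε ≤ p σ) (hp1 : ∀ σ, ε ≤ 1 - p σ) :
    ∀ᵐ X ∂((Measure.infinitePi fun σ => bitLaw (p σ)).map ofBits), X.IsRado := by
  have key : ∀ (U : Finset ℕ) (A : Finset (Finset ℕ)),
      (∀ σ ∈ A, ∀ τ ⊆ σ, τ.Nonempty → τ ∈ A) →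
      ∀ᵐ X ∂((Measure.infinitePi fun σ => bitLaw (p σ)).map ofBits),
        ∃ v, SComplex.Realizes X U A v := fun U A hA => by
    rw [ae_map_iff measurable_ofBits.aemeasurable
      (measurableSet_setOfPred.2 (Measurable.exists (measurable_realizes U A)))]
    exact ae_exists_realizes p hε hp0 hp1 U hA
  have key' := ae_all_iff.2 fun U => ae_all_iff.2 fun A => ae_all_iff.2 (key U A)
  filter_upwards [key'] with X hX
  exact (ampleProp_of_forall_realizes fun U A hA _ => hX U A hA).isRado

end Product

end SComplex

/-- If the probability parameters are in the medial regime
(`0 < p₋ ≤ p σ ≤ p₊ < 1` for all simplexes `σ`), then for any probability measure `μ`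
on `(Ω, A')` with `μ(Z(Y,n)) = ∏_{σ ∈ F(Y)} p σ · ∏_{σ ∈ E(Y|Δ_n)} (1 - p σ)` for all
`n` and all subcomplexes `Y ⊆ Δ_n`, the set of Rado complexes has `μ`-measure `1`. -/
theorem random_complex_is_rado (p : Finset ℕ → ℝ) (pLow pHigh : ℝ)
    (h0 : 0 < pLow) (hlh : pLow ≤ pHigh) (h1 : pHigh < 1)
    (hp : ∀ σ : Finset ℕ, σ.Nonempty → p σ ∈ Set.Icc pLow pHigh)
    (μ : MeasureTheory.Measure SComplex) (hprob : MeasureTheory.IsProbabilityMeasure μ)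
    (hμ : ∀ (n : ℕ) (Y : SComplex), Y.On n →
      μ (cylinder Y n) =
        ENNReal.ofReal ((∏ᶠ σ ∈ Y.faces, p σ) * ∏ᶠ σ ∈ externalIn Y n, (1 - p σ))) :
    μ {X : SComplex | X.IsRado} = 1 := by
  let r : Finset ℕ → ℝ := fun σ => if σ.Nonempty then p σ else pLow
  have hr : ∀ σ, r σ ∈ Set.Icc pLow pHigh := fun σ => by
    by_cases hσ : σ.Nonempty
    · simpa [r, hσ] using hp σ hσ
    · simp [r, hσ, hlh]
  have hpr : ∀ σ : Finset ℕ, σ.Nonempty → p σ = r σ := fun σ hσ => by simp [r, hσ]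
  have hinst : ∀ σ, MeasureTheory.IsProbabilityMeasure (SComplex.bitLaw (r σ)) := fun σ =>
    SComplex.isProbabilityMeasure_bitLaw (by linarith [(hr σ).1]) (by linarith [(hr σ).2])
  have hlaw : μ =
      (MeasureTheory.Measure.infinitePi fun σ => SComplex.bitLaw (r σ)).map SComplex.ofBits := by
    have := MeasureTheory.Measure.isProbabilityMeasure_map
      (μ := MeasureTheory.Measure.infinitePi fun σ => SComplex.bitLaw (r σ))
      SComplex.measurable_ofBits.aemeasurable
    refine MeasureTheory.ext_of_generate_finite _ rfl SComplex.isPiSystem_cylinder ?_ (by simp)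
    rintro _ ⟨n, Y, hY, rfl⟩
    rw [hμ n Y hY, SComplex.map_ofBits_cylinder r (fun σ => by linarith [(hr σ).1])
      (fun σ => by linarith [(hr σ).2]) hY,
      finprod_mem_congr rfl fun σ hσ => hpr σ (Y.nonempty_of_mem σ hσ),
      finprod_mem_congr rfl fun σ hσ => congrArg (1 - ·) (hpr σ hσ.2.1)]
  have hae : ∀ᵐ X ∂μ, X.IsRado := by
    rw [hlaw]
    exact SComplex.ae_isRado r (ε := min pLow (1 - pHigh)) (lt_min h0 (by linarith))
      (fun σ => (min_le_left _ _).trans (hr σ).1)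
      (fun σ => (min_le_right _ _).trans (by linarith [(hr σ).2]))
  rw [MeasureTheory.measure_congr (Filter.eventuallyEq_univ.2 hae), MeasureTheory.measure_univ]
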